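/- arXiv:2311.17747 — 6 statements merged into one kernel-verified Lean document; each statement's English description precedes it below -/
import Mathlib

section
/- Let F be a finite field with q elements and let t be a real number with 0 < t < 1/q. Then the family indexed by monic irreducible polynomials P ∈ F[X], with value (1 − t^{deg P})⁻¹, is multipliable, and its product equals 1/(1 − q·t). -/
lemma aux_fin {ι : Type*} [DecidableEq ι] (a : ι → ℝ) (h0 : ∀ i, 0 ≤ a i) (h1 : ∀ i, a i < 1)
    (S : Finset ι) :
    HasSum (Set.indicator {m : ι →₀ ℕ | m.support ⊆ S} (fun m => m.prod fun i k => a i ^ k))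
      (∏ i ∈ S, (1 - a i)⁻¹) := by
  induction S using Finset.induction_on with
  | empty =>
    have : HasSum (Set.indicator {m : ι →₀ ℕ | m.support ⊆ ∅}
        (fun m => m.prod fun i k => a i ^ k)) (Set.indicator {m : ι →₀ ℕ | m.support ⊆ ∅}
        (fun m => m.prod fun i k => a i ^ k) 0) := by
      apply hasSum_single
      intro m hm
      apply Set.indicator_of_notMem
      simpa using hm
    simpa using this
  | insert i S hi ih =>
    rw [Finset.prod_insert hi]
    have hg := hasSum_geometric_of_lt_one (h0 i) (h1 i)
    have ih' := hasSum_subtype_iff_indicator.mpr ih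
    have hnn : ∀ m : ι →₀ ℕ, 0 ≤ m.prod fun i k => a i ^ k := fun m =>
      Finset.prod_nonneg fun j _ => pow_nonneg (h0 j) _
    have hs := hg.summable.mul_of_nonneg ih'.summable
      (fun k => pow_nonneg (h0 i) k) (fun m => hnn _)
    have hmul := hg.mul ih' hs
    let e : ℕ × {m : ι →₀ ℕ | m.support ⊆ S} → (ι →₀ ℕ) :=
      fun x => Finsupp.single i x.1 + x.2.1
    have hz : ∀ m : {m : ι →₀ ℕ | m.support ⊆ S}, m.1 i = 0 := by
      intro m
      by_contra h
      exact hi (m.2 (Finsupp.mem_support_iff.mpr h))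
    have he : Function.Injective e := by
      rintro ⟨k, m⟩ ⟨k', m'⟩ h
      have h2 : k = k' := by
        have := DFunLike.congr_fun h i
        simpa [e, hz] using this
      subst h2
      have : m.1 = m'.1 := add_left_cancel h
      rw [Subtype.ext this]
    rw [← he.hasSum_iff]
    · suffices h : ∀ x, (Set.indicator {m : ι →₀ ℕ | m.support ⊆ insert i S}
          (fun m => m.prod fun i k => a i ^ k) ∘ e) x = a i ^ x.1 *
          ((fun m : ι →₀ ℕ => m.prod fun i k => a i ^ k) ∘ Subtype.val) x.2 by
        rw [funext h]
        exact hmul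
      rintro ⟨k, m⟩
      have hmem : e (k, m) ∈ {m : ι →₀ ℕ | m.support ⊆ insert i S} := by
        refine Finsupp.support_add.trans (Finset.union_subset ?_ ?_)
        · exact Finsupp.support_single_subset.trans (by simp)
        · exact m.2.trans (Finset.subset_insert _ _)
      simp only [Function.comp, Set.indicator_of_mem hmem]
      simp only [e]
      rw [Finsupp.prod_add_index' (by simp) (by intros; rw [pow_add]),
        Finsupp.prod_single_index (by simp)]
    · intro m hm
      apply Set.indicator_of_notMem
      intro hmem
      apply hm
      refine ⟨(m i, ⟨m.erase i, ?_⟩), ?_⟩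
      · simp only [Set.mem_ofPred_eq] at hmem ⊢
        rw [Finsupp.support_erase]
        intro j hj
        have := hmem (Finset.mem_of_mem_erase hj)
        exact (Finset.mem_insert.mp this).resolve_left (Finset.ne_of_mem_erase hj)
      · simp [e, Finsupp.single_add_erase]

lemma aux_prod {ι : Type*} (a : ι → ℝ) (h0 : ∀ i, 0 ≤ a i) (h1 : ∀ i, a i < 1) (T : ℝ)
    (hT : HasSum (fun m : ι →₀ ℕ => m.prod fun i k => a i ^ k) T) :
    HasProd (fun i => (1 - a i)⁻¹) T := by
  classical
  have hnn : ∀ m : ι →₀ ℕ, 0 ≤ m.prod fun i k => a i ^ k := fun m =>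
    Finset.prod_nonneg fun j _ => pow_nonneg (h0 j) _
  rw [HasProd, SummationFilter.unconditional_filter, ← hT.tsum_eq]
  have : (fun S : Finset ι => ∏ i ∈ S, (1 - a i)⁻¹) = fun S =>
      ∑' m, Set.indicator {m : ι →₀ ℕ | m.support ⊆ S} (fun m => m.prod fun i k => a i ^ k) m := by
    ext S
    exact (aux_fin a h0 h1 S).tsum_eq.symm
  rw [this]
  refine tendsto_tsum_of_dominated_convergence hT.summable ?_ ?_
  · intro m
    apply tendsto_const_nhds.congr'
    filter_upwards [Filter.eventually_ge_atTop m.support] with S hS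
    rw [Set.indicator_of_mem]
    exact hS
  · refine Filter.Eventually.of_forall fun S m => ?_
    refine (norm_indicator_le_norm_self _ _).trans ?_
    rw [Real.norm_of_nonneg (hnn m)]

lemma aux_monic (F : Type) [Field F] [Fintype F] (t : ℝ) (ht0 : 0 < t)
    (ht1 : (Fintype.card F : ℝ) * t < 1) :
    HasSum (fun p : {p : Polynomial F // p.Monic} => t ^ p.1.natDegree)
      (1 - Fintype.card F * t)⁻¹ := by
  let e : (Σ n : ℕ, {p : Polynomial F // p.Monic ∧ p.natDegree = n}) ≃
      {p : Polynomial F // p.Monic} :=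
    { toFun := fun x => ⟨x.2.1, x.2.2.1⟩
      invFun := fun p => ⟨p.1.natDegree, p.1, p.2, rfl⟩
      left_inv := by rintro ⟨n, p, hp, rfl⟩; rfl
      right_inv := fun p => rfl }
  rw [← e.hasSum_iff]
  have hfin : ∀ n : ℕ, HasSum (fun p : {p : Polynomial F // p.Monic ∧ p.natDegree = n} =>
      t ^ p.1.natDegree) ((Fintype.card F * t) ^ n) := by
    intro n
    let E := (Polynomial.monicEquivDegreeLT (R := F) n).trans
      (Polynomial.degreeLTEquiv F n).toEquiv
    rw [← E.symm.hasSum_iff]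
    have : ∀ v, ((fun p : {p : Polynomial F // p.Monic ∧ p.natDegree = n} =>
      t ^ p.1.natDegree) ∘ E.symm) v = t ^ n := by
      intro v
      simp only [Function.comp, (E.symm v).2.2]
    rw [funext this]
    convert hasSum_fintype (fun _ : Fin n → F => t ^ n) using 1
    simp [mul_pow]
  have hg := hasSum_geometric_of_lt_one (by positivity) ht1
  have hs : Summable ((fun p : {p : Polynomial F // p.Monic} => t ^ p.1.natDegree) ∘ e) := by
    refine (summable_sigma_of_nonneg ?_).mpr ⟨fun n => (hfin n).summable, ?_⟩
    · exact fun x => pow_nonneg ht0.le _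
    convert hg.summable using 2 with n
    exact (hfin n).tsum_eq
  have := hs.hasSum.sigma hfin
  rw [← this.unique hg]
  exact hs.hasSum

open UniqueFactorizationMonoid in
lemma aux_bij (F : Type) [Field F] :
    ∃ e : ({P : Polynomial F // P.Monic ∧ Irreducible P} →₀ ℕ) ≃ {p : Polynomial F // p.Monic},
      ∀ m, (e m).1 = m.prod fun P k => P.1 ^ k := by
  classical
  let I := {P : Polynomial F // P.Monic ∧ Irreducible P}
  have hm : ∀ s : Multiset I, (s.map Subtype.val).prod.Monic := fun s =>
    Polynomial.monic_multiset_prod_of_monic _ _ fun i _ => i.2.1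
  let φ : Multiset I → {p : Polynomial F // p.Monic} := fun s => ⟨(s.map Subtype.val).prod, hm s⟩
  have hφ : Function.Bijective φ := by
    constructor
    · intro s s' h
      have key : ∀ s : Multiset I, normalizedFactors (s.map Subtype.val).prod
          = s.map Subtype.val := by
        intro s
        rw [normalizedFactors_prod_eq, Multiset.map_map]
        · exact Multiset.map_congr rfl fun i _ => i.2.1.normalize_eq_self
        · intro a ha
          obtain ⟨i, _, rfl⟩ := Multiset.mem_map.mp ha
          exact i.2.2
      have h' : (s.map Subtype.val).prod = (s'.map Subtype.val).prod := congrArg Subtype.val h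
      apply Multiset.map_injective Subtype.val_injective
      rw [← key s, ← key s', h']
    · rintro ⟨p, hp⟩
      have hI : ∀ x ∈ normalizedFactors p, x.Monic ∧ Irreducible x := by
        intro x hx
        have hirr := irreducible_of_normalized_factor x hx
        refine ⟨?_, hirr⟩
        rw [← normalize_normalized_factor x hx]
        exact Polynomial.monic_normalize hirr.ne_zero
      refine ⟨(normalizedFactors p).pmap Subtype.mk hI, ?_⟩
      apply Subtype.ext
      simp only [φ]
      rw [Multiset.map_pmap]
      simp only [Multiset.pmap_eq_map, Multiset.map_id']
      rw [prod_normalizedFactors_eq hp.ne_zero, hp.normalize_eq_self]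
  refine ⟨Multiset.toFinsupp.symm.toEquiv.trans (Equiv.ofBijective φ hφ), fun m => ?_⟩
  change ((Finsupp.toMultiset m).map Subtype.val).prod = _
  induction m using Finsupp.induction_linear with
  | zero => simp
  | add f g hf hg =>
    rw [map_add, Multiset.map_add, Multiset.prod_add, hf, hg,
      Finsupp.prod_add_index' (by simp) (by intros; rw [pow_add])]
  | single a b => simp [Finsupp.toMultiset_single, Multiset.map_nsmul, Multiset.prod_nsmul]

/-- Euler product for the zeta function of the affine line over a finite field with `q`
elements: the product over monic irreducible polynomials `P` of `(1 - t ^ deg P)⁻¹`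
converges and equals `1 / (1 - q t)` for `0 < t < 1/q`. -/
theorem stmt_1 (F : Type) [Field F] [Fintype F] (q : ℕ) (hq : Fintype.card F = q)
    (t : ℝ) (ht0 : 0 < t) (ht1 : t < 1 / q) :
    Multipliable (fun P : {P : Polynomial F // P.Monic ∧ Irreducible P} =>
      ((1 : ℝ) - t ^ P.1.natDegree)⁻¹) ∧
    ∏' P : {P : Polynomial F // P.Monic ∧ Irreducible P},
      ((1 : ℝ) - t ^ P.1.natDegree)⁻¹ = 1 / (1 - q * t) := by
  subst hq
  have hqpos : (0 : ℝ) < Fintype.card F := by exact_mod_cast Fintype.card_pos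
  have h1 : (Fintype.card F : ℝ) * t < 1 := by
    rw [lt_div_iff₀ hqpos] at ht1
    linarith
  have hq1 : (1 : ℝ) ≤ Fintype.card F := by exact_mod_cast Fintype.card_pos
  have htlt : t < 1 := by nlinarith
  obtain ⟨e, he⟩ := aux_bij F
  have hsum := aux_monic F t ht0 h1
  rw [← e.hasSum_iff] at hsum
  have hp := aux_prod (fun P : {P : Polynomial F // P.Monic ∧ Irreducible P} =>
      t ^ P.1.natDegree) (fun P => by positivity)
      (fun P => pow_lt_one₀ ht0.le htlt P.2.2.natDegree_pos.ne') _ (by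
        convert hsum using 1
        ext m
        simp only [Function.comp, he, Finsupp.prod]
        rw [Polynomial.natDegree_prod_of_monic _ _ (fun P _ => P.2.1.pow _),
          ← Finset.prod_pow_eq_pow_sum]
        refine Finset.prod_congr rfl fun P _ => ?_
        rw [P.2.1.natDegree_pow, ← pow_mul, mul_comm])
  exact ⟨hp.multipliable, by rw [hp.tprod_eq, one_div]⟩
end

section
/- Let q > 1 be real and a a nonzero complex number with a² ≠ q. Then the Eisenstein series E(k, a) is an eigenfunction of the Hecke operator with eigenvalue λ(a) = √q·(a + a⁻¹): for every natural number k ≥ 1, q·E(k−1, a) + E(k+1, a) = √q·(a + a⁻¹)·E(k, a), and at the boundary, (q + 1)·E(1, a) = √q·(a + a⁻¹)·E(0, a). -/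
/-- The Eisenstein series for `PGL(2)` over the function field of `ℙ¹` over `𝔽_q`, evaluated at
the bundle `𝒫_k = ℙ(𝒪(k) ⊕ 𝒪)` and spectral parameter `a`:
`E(k, a) = (√q·a)^k + ((q·a² − 1)/(a² − q))·(√q·a⁻¹)^k`. -/
noncomputable def Eis (q : ℝ) (a : ℂ) (k : ℕ) : ℂ :=
  ((Real.sqrt q : ℂ) * a) ^ k +
    (((q : ℂ) * a ^ 2 - 1) / (a ^ 2 - (q : ℂ))) * ((Real.sqrt q : ℂ) * a⁻¹) ^ k

/-- The Eisenstein series is an eigenfunction of the Hecke operator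
`(Δf)(k) = q f(k−1) + f(k+1)` (for `k ≥ 1`), `(Δf)(0) = (q+1) f(1)`, with eigenvalue
`λ(a) = √q (a + a⁻¹)`. -/
theorem stmt_2 (q : ℝ) (hq : 1 < q) (a : ℂ) (ha : a ≠ 0) (ha2 : a ^ 2 ≠ (q : ℂ)) :
    (∀ k : ℕ, 1 ≤ k →
      (q : ℂ) * Eis q a (k - 1) + Eis q a (k + 1)
        = (Real.sqrt q : ℂ) * (a + a⁻¹) * Eis q a k) ∧
    ((q : ℂ) + 1) * Eis q a 1 = (Real.sqrt q : ℂ) * (a + a⁻¹) * Eis q a 0 := by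
  have hs : (Real.sqrt q : ℂ) * (Real.sqrt q : ℂ) = (q : ℂ) := by
    rw [← Complex.ofReal_mul, Real.mul_self_sqrt (by linarith)]
  have hd : a ^ 2 - (q : ℂ) ≠ 0 := sub_ne_zero.mpr ha2
  have hi : a * a⁻¹ = 1 := mul_inv_cancel₀ ha
  have hc : ((q : ℂ) * a ^ 2 - 1) / (a ^ 2 - (q : ℂ)) * (a ^ 2 - (q : ℂ)) = (q : ℂ) * a ^ 2 - 1 :=
    div_mul_cancel₀ _ hd
  unfold Eis
  generalize ((q : ℂ) * a ^ 2 - 1) / (a ^ 2 - (q : ℂ)) = c at *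
  generalize (Real.sqrt q : ℂ) = s at *
  generalize (q : ℂ) = r at *
  generalize a⁻¹ = b at *
  constructor
  · intro k hk
    obtain ⟨n, rfl⟩ : ∃ n, k = n + 1 := ⟨k - 1, by omega⟩
    simp only [Nat.add_sub_cancel]
    rw [pow_succ (s * a) (n + 1), pow_succ (s * a) n, pow_succ (s * b) (n + 1), pow_succ (s * b) n]
    generalize (s * a) ^ n = x
    generalize (s * b) ^ n = y
    subst hs
    linear_combination (-(s * s * (x + c * y))) * hi
  · simp only [pow_one, pow_zero]
    linear_combination (-(s * b)) * hc + (s * c * a - s * r * a) * hi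
end

section
/- Let q > 1 be real, k a natural number, and ε ∈ {1, −1}. Then the function a ↦ E(k, a)/a has a simple pole at a = ε·√q with residue ((q − q⁻¹)/2)·ε^k; precisely, (a − ε·√q)·E(k, a)/a tends to ((q − q⁻¹)/2)·ε^k as a tends to ε·√q along complex numbers a with a ≠ 0 and a² ≠ q. -/
/-- `a ↦ E(k, a)/a` has a simple pole at `a = ε√q` (for `ε = ±1`) with residue
`((q − q⁻¹)/2)·ε^k`. -/
theorem stmt_4 (q : ℝ) (hq : 1 < q) (k : ℕ) (ε : ℝ) (hε : ε = 1 ∨ ε = -1) :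
    Filter.Tendsto (fun a : ℂ => (a - (ε : ℂ) * (Real.sqrt q : ℂ)) * Eis q a k / a)
      (nhdsWithin ((ε : ℂ) * (Real.sqrt q : ℂ)) {a : ℂ | a ≠ 0 ∧ a ^ 2 ≠ (q : ℂ)})
      (nhds ((((q : ℂ) - (q : ℂ)⁻¹) / 2) * (ε : ℂ) ^ k)) := by
  have hq0 : (q : ℂ) ≠ 0 := by
    have : q ≠ 0 := by linarith
    exact_mod_cast this
  have hs2 : (Real.sqrt q : ℂ) ^ 2 = (q : ℂ) := by
    have := Real.sq_sqrt (show (0 : ℝ) ≤ q by linarith)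
    exact_mod_cast this
  have he2 : (ε : ℂ) ^ 2 = 1 := by
    rcases hε with h | h <;> simp [h]
  have heinv : (ε : ℂ)⁻¹ = ε := by
    rcases hε with h | h <;> simp [h]
  unfold Eis
  generalize (Real.sqrt q : ℂ) = s at *
  generalize (ε : ℂ) = e at *
  generalize (q : ℂ) = Q at *
  have hs0 : s ≠ 0 := by
    rintro rfl
    apply hq0
    rw [← hs2]
    ring
  have he0 : e ≠ 0 := by
    rintro rfl
    norm_num at he2
  have h0 : e * s ≠ 0 := mul_ne_zero he0 hs0
  have hsq : (e * s) ^ 2 = Q := by rw [mul_pow, he2, hs2, one_mul]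
  have h2 : e * s + e * s ≠ 0 := by
    rw [← two_mul]
    exact mul_ne_zero two_ne_zero h0
  have hc : ContinuousAt (fun a : ℂ => (a - e * s) * (s * a) ^ k / a +
      ((Q * a ^ 2 - 1) / (a + e * s)) * (s * a⁻¹) ^ k / a) (e * s) := by
    fun_prop (disch := assumption)
  have hv : (e * s - e * s) * (s * (e * s)) ^ k / (e * s) +
      ((Q * (e * s) ^ 2 - 1) / (e * s + e * s)) * (s * (e * s)⁻¹) ^ k / (e * s)
      = (Q - Q⁻¹) / 2 * e ^ k := by
    have h3 : s * (e * s)⁻¹ = e := by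
      rw [mul_inv, heinv]
      field_simp
    rw [h3, hsq, sub_self, ← two_mul]
    have h4 : (Q * Q - 1) / (2 * (e * s)) * e ^ k / (e * s)
        = (Q * Q - 1) / (2 * (e * s) ^ 2) * e ^ k := by
      field_simp
    rw [h4, hsq]
    field_simp
    ring
  have ht := hc.tendsto
  simp only [hv] at ht
  refine (ht.mono_left nhdsWithin_le_nhds).congr' ?_
  filter_upwards [self_mem_nhdsWithin] with a ha
  obtain ⟨ha0, ha2⟩ := ha
  have hf : a ^ 2 - Q = (a - e * s) * (a + e * s) := by
    rw [← hsq]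
    ring
  have hne : (a - e * s) * (a + e * s) ≠ 0 := by
    rw [← hf]
    exact sub_ne_zero.mpr ha2
  have hm := left_ne_zero_of_mul hne
  have hp := right_ne_zero_of_mul hne
  rw [hf]
  generalize (s * a⁻¹) ^ k = X
  generalize (s * a) ^ k = Y
  field_simp
end

section
/- Let q > 1 be real. Define weights w : ℕ → ℝ by w(0) = 1/(q(q² − 1)) and w(k) = 1/(q^{k+1}(q − 1)) for k ≥ 1, and the Hecke operator Δ on functions f : ℕ → ℂ by (Δf)(0) = (q+1)·f(1) and (Δf)(k) = q·f(k−1) + f(k+1) for k ≥ 1. Then Δ is symmetric for the weighted hermitian pairing: for all finitely supported functions f, g : ℕ → ℂ, ∑_{k∈ℕ} w(k)·(Δf)(k)·conj(g(k)) = ∑_{k∈ℕ} w(k)·f(k)·conj((Δg)(k)). -/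
/-- The weights `w(k) = 1/|Aut(𝒫_k)|` on `Bun_{PGL(2)}(ℙ¹) ≅ ℕ`:
`w(0) = 1/(q(q² − 1))` and `w(k) = 1/(q^(k+1)(q − 1))` for `k ≥ 1`. -/
noncomputable def wgt (q : ℝ) : ℕ → ℝ
  | 0 => 1 / (q * (q ^ 2 - 1))
  | k + 1 => 1 / (q ^ (k + 2) * (q - 1))

/-- The Hecke operator `(Δf)(0) = (q+1) f(1)`, `(Δf)(k) = q f(k−1) + f(k+1)` for `k ≥ 1`. -/
noncomputable def Hecke (q : ℝ) (f : ℕ → ℂ) : ℕ → ℂ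
  | 0 => ((q : ℂ) + 1) * f 1
  | k + 1 => (q : ℂ) * f k + f (k + 2)

theorem partial_aux (q : ℝ) (hq : 1 < q) (f g : ℕ → ℂ) (n : ℕ) :
    ∑ k ∈ Finset.range (n + 1), (wgt q k : ℂ) * Hecke q f k * (starRingEnd ℂ) (g k)
      = ∑ k ∈ Finset.range (n + 1), (wgt q k : ℂ) * f k * (starRingEnd ℂ) (Hecke q g k)
        + (1 / ((q : ℂ) ^ (n + 1) * ((q : ℂ) - 1))) *
          (f (n + 1) * (starRingEnd ℂ) (g n) - f n * (starRingEnd ℂ) (g (n + 1))) := by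
  have h0 : (q : ℂ) ≠ 0 := by
    exact_mod_cast (by linarith : q ≠ 0)
  have h1 : (q : ℂ) - 1 ≠ 0 := by
    exact_mod_cast (by linarith [sub_pos.2 hq] : q - 1 ≠ 0)
  have h2 : (q : ℂ) + 1 ≠ 0 := by
    exact_mod_cast (by linarith : q + 1 ≠ 0)
  have h3 : (q : ℂ) ^ 2 - 1 ≠ 0 := by
    have : (q : ℂ) ^ 2 - 1 = (q - 1) * (q + 1) := by ring
    rw [this]; exact mul_ne_zero h1 h2
  induction n with
  | zero =>
    have e : 1 / ((q : ℂ) * ((q : ℂ) ^ 2 - 1)) * (q + 1) = 1 / ((q : ℂ) * ((q : ℂ) - 1)) := by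
      have : (q : ℂ) ^ 2 - 1 = (q - 1) * (q + 1) := by ring
      rw [this]; field_simp
    simp only [zero_add, Finset.sum_range_one, wgt, Hecke, map_mul, map_add, Complex.conj_ofReal,
      map_one, pow_one]
    push_cast
    rw [← e]; ring
  | succ n ih =>
    rw [Finset.sum_range_succ, ih, Finset.sum_range_succ _ (n + 1)]
    have e : 1 / ((q : ℂ) ^ (n + 1) * ((q : ℂ) - 1))
        = 1 / ((q : ℂ) ^ (n + 2) * ((q : ℂ) - 1)) * q := by
      field_simp
      ring
    simp only [wgt, Hecke, map_mul, map_add, Complex.conj_ofReal]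
    push_cast
    rw [e]; ring

/-- The Hecke operator is symmetric for the weighted hermitian pairing
`⟨f, g⟩ = ∑ₖ w(k) f(k) conj(g(k))` on finitely supported functions. -/
theorem stmt_5 (q : ℝ) (hq : 1 < q) (f g : ℕ → ℂ)
    (hf : (Function.support f).Finite) (hg : (Function.support g).Finite) :
    ∑' k : ℕ, (wgt q k : ℂ) * Hecke q f k * (starRingEnd ℂ) (g k)
      = ∑' k : ℕ, (wgt q k : ℂ) * f k * (starRingEnd ℂ) (Hecke q g k) := by
  obtain ⟨a, ha⟩ := hf.bddAbove
  obtain ⟨b, hb⟩ := hg.bddAbove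
  have hf0 : ∀ k, a + b < k → f k = 0 := by
    intro k hk
    by_contra h
    have := ha (show k ∈ Function.support f from h)
    omega
  have hg0 : ∀ k, a + b < k → g k = 0 := by
    intro k hk
    by_contra h
    have := hb (show k ∈ Function.support g from h)
    omega
  rw [tsum_eq_sum (s := Finset.range (a + b + 1 + 1)), tsum_eq_sum (s := Finset.range (a + b + 1 + 1)),
    partial_aux q hq, hf0 (a + b + 1) (by omega), hf0 (a + b + 1 + 1) (by omega)]
  · simp
  · intro k hk
    rw [Finset.mem_range] at hk
    rw [hf0 k (by omega)]; simp
  · intro k hk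
    rw [Finset.mem_range] at hk
    rw [hg0 k (by omega)]; simp
end

section
/- Let q > 1 be real, k a natural number, m an integer, and R a real number with R > √q. Then (1/(2πi))·∮_{|a|=R} E(k, a)·a^{m−1} da = (1/(2πi))·∮_{|a|=1} E(k, a)·a^{m−1} da + ((q − q⁻¹)/2)·((√q)^m + (−1)^k·(−√q)^m), where ∮_{|a|=c} denotes the integral over the circle of radius c centered at 0 traversed once counterclockwise (and for m < 0, a^{m−1} is the integer power of the nonzero complex number a). -/
open Metric Set in
lemma annulus_eq (H : ℂ → ℂ) (S : Set ℂ) (hS : S.Countable) (hc : ContinuousOn H {0}ᶜ)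
    (hd : ∀ z, z ≠ 0 → z ∉ S → DifferentiableAt ℂ H z) (R : ℝ) (hR : 1 ≤ R) :
    (∮ a in C(0, R), H a) = ∮ a in C(0, (1:ℝ)), H a := by
  refine Complex.circleIntegral_eq_of_differentiable_on_annulus_off_countable one_pos hR hS
    (hc.mono ?_) ?_
  · rintro z ⟨_, hz⟩ h0
    rw [Set.mem_singleton_iff] at h0
    subst h0
    simp at hz
  · rintro z ⟨⟨_, hz⟩, hzS⟩
    refine hd z ?_ hzS
    rintro rfl
    simp at hz

open Metric Set in
lemma residue_step (H : ℂ → ℂ) (hd : ∀ z, z ≠ 0 → DifferentiableAt ℂ H z) (w : ℂ)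
    (hw : 1 < ‖w‖) (R : ℝ) (hR : ‖w‖ < R) :
    (∮ a in C(0, R), H a * (a - w)⁻¹) =
      (∮ a in C(0, (1:ℝ)), H a * (a - w)⁻¹) + 2 * (Real.pi : ℂ) * Complex.I * H w := by
  have hw0 : w ≠ 0 := by
    rintro rfl
    simp at hw
    linarith
  have hcH : ContinuousOn H {0}ᶜ := fun z hz => (hd z hz).continuousAt.continuousWithinAt
  have h1 : (∮ a in C(0, R), dslope H w a) = ∮ a in C(0, (1:ℝ)), dslope H w a := by
    refine annulus_eq _ {w} (countable_singleton _) ?_ ?_ R (by linarith)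
    · rw [continuousOn_dslope (isOpen_compl_singleton.mem_nhds hw0)]
      exact ⟨hcH, hd w hw0⟩
    · intro z hz hzw
      exact (differentiableAt_dslope_of_ne hzw).2 (hd z hz)
  have key : ∀ r : ℝ, 0 < r → r ≠ ‖w‖ → (∮ a in C(0, r), dslope H w a) =
      (∮ a in C(0, r), H a * (a - w)⁻¹) - H w * ∮ a in C(0, r), (a - w)⁻¹ := by
    intro r hr hrw
    have hne : ∀ z ∈ sphere (0:ℂ) r, z ≠ w := by
      rintro z hz rfl
      simp at hz
      exact hrw hz.symm
    have hi : ContinuousOn (fun a : ℂ => (a - w)⁻¹) (sphere 0 r) :=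
      ContinuousOn.inv₀ (by fun_prop) fun z hz => sub_ne_zero.2 (hne z hz)
    have hHs : ContinuousOn H (sphere 0 r) := hcH.mono (by
      rintro z hz h0
      rw [Set.mem_singleton_iff] at h0
      subst h0
      simp at hz
      exact hr.ne hz)
    have i1 : CircleIntegrable (fun a : ℂ => H a * (a - w)⁻¹) 0 r :=
      (hHs.mul hi).circleIntegrable hr.le
    have i2 : CircleIntegrable (fun a : ℂ => H w * (a - w)⁻¹) 0 r :=
      (continuousOn_const.mul hi).circleIntegrable hr.le
    rw [← circleIntegral.integral_const_mul, ← circleIntegral.integral_sub i1 i2]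
    refine circleIntegral.integral_congr hr.le fun z hz => ?_
    simp only [dslope_of_ne _ (hne z hz), slope_def_field]
    rw [div_eq_mul_inv]
    ring
  rw [key R (by linarith) hR.ne', key 1 one_pos hw.ne,
    circleIntegral.integral_sub_inv_of_mem_ball (by simpa using hR)] at h1
  have h2 : (∮ a in C(0, (1:ℝ)), (a - w)⁻¹) = 0 := by
    have hne : ∀ z ∈ closedBall (0:ℂ) 1, z - w ≠ 0 := by
      intro z hz h
      rw [sub_eq_zero] at h
      subst h
      simp at hz
      linarith
    refine Complex.circleIntegral_eq_zero_of_differentiable_on_off_countable zero_le_one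
      countable_empty (ContinuousOn.inv₀ (by fun_prop) hne) ?_
    intro z hz
    exact DifferentiableAt.inv (by fun_prop) (hne z (ball_subset_closedBall hz.1))
  rw [h2] at h1
  linear_combination h1

/-- Contour shrinking for the spectral decomposition: moving the contour from `|a| = R > √q`
to `|a| = 1` picks up the residues at `a = ±√q`. -/
theorem stmt_13 (q : ℝ) (hq : 1 < q) (k : ℕ) (m : ℤ) (R : ℝ) (hR : Real.sqrt q < R) :
    (1 / (2 * (Real.pi : ℂ) * Complex.I)) *
        (∮ a in C(0, R), Eis q a k * a ^ (m - 1))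
      = (1 / (2 * (Real.pi : ℂ) * Complex.I)) *
          (∮ a in C(0, (1 : ℝ)), Eis q a k * a ^ (m - 1)) +
        (((q : ℂ) - (q : ℂ)⁻¹) / 2) *
          ((Real.sqrt q : ℂ) ^ m + (-1 : ℂ) ^ k * (-(Real.sqrt q : ℂ)) ^ m) := by
  set s : ℂ := (Real.sqrt q : ℂ) with hs
  have hs2 : s ^ 2 = q := by
    rw [hs, ← Complex.ofReal_pow, Real.sq_sqrt (by linarith)]
  have hs1 : 1 < Real.sqrt q := by
    rw [Real.lt_sqrt zero_le_one]
    simpa using hq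
  have hns : ‖s‖ = Real.sqrt q := by
    rw [hs, Complex.norm_real, Real.norm_of_nonneg (by linarith)]
  have hs0 : s ≠ 0 := by
    intro h
    rw [h, norm_zero] at hns
    linarith
  let A : ℂ → ℂ := fun a => (s * a) ^ k * a ^ (m - 1)
  let H : ℂ → ℂ := fun a => ((q : ℂ) * a ^ 2 - 1) / (2 * s) * (s * a⁻¹) ^ k * a ^ (m - 1)
  have hzp : ∀ z : ℂ, z ≠ 0 → DifferentiableAt ℂ (fun a : ℂ => a ^ (m - 1)) z := fun z hz =>
    differentiableAt_zpow.2 (Or.inl hz)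
  have hA : ∀ z, z ≠ 0 → DifferentiableAt ℂ A z := fun z hz =>
    DifferentiableAt.mul (by fun_prop) (hzp z hz)
  have hH : ∀ z, z ≠ 0 → DifferentiableAt ℂ H z := fun z hz =>
    DifferentiableAt.mul (by fun_prop (disch := assumption)) (hzp z hz)
  have hAc : ContinuousOn A {0}ᶜ := fun z hz => (hA z hz).continuousAt.continuousWithinAt
  have hHc : ContinuousOn H {0}ᶜ := fun z hz => (hH z hz).continuousAt.continuousWithinAt
  have split : ∀ r : ℝ, 0 < r → r ≠ Real.sqrt q →
      (∮ a in C(0, r), Eis q a k * a ^ (m - 1)) = (∮ a in C(0, r), A a) +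
        ((∮ a in C(0, r), H a * (a - s)⁻¹) - ∮ a in C(0, r), H a * (a - -s)⁻¹) := by
    intro r hr hrs
    have hsub : Metric.sphere (0:ℂ) r ⊆ {0}ᶜ := by
      rintro z hz h0
      rw [Set.mem_singleton_iff] at h0
      subst h0
      simp at hz
      exact hr.ne hz
    have hne : ∀ z ∈ Metric.sphere (0:ℂ) r, ∀ w : ℂ, ‖w‖ = Real.sqrt q → z - w ≠ 0 := by
      rintro z hz w hw h
      rw [sub_eq_zero] at h
      subst h
      simp at hz
      exact hrs (hz.symm.trans hw)
    have hi : ∀ w : ℂ, ‖w‖ = Real.sqrt q →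
        CircleIntegrable (fun a : ℂ => H a * (a - w)⁻¹) 0 r := fun w hw =>
      ((hHc.mono hsub).mul (ContinuousOn.inv₀ (by fun_prop)
        fun z hz => hne z hz w hw)).circleIntegrable hr.le
    have hns' : ‖-s‖ = Real.sqrt q := by rw [norm_neg, hns]
    have i3 : CircleIntegrable (fun a : ℂ => H a * (a - s)⁻¹ - H a * (a - -s)⁻¹) 0 r :=
      (hi s hns).sub (hi (-s) hns')
    rw [← circleIntegral.integral_sub (hi s hns) (hi (-s) hns'),
      ← circleIntegral.integral_add ((hAc.mono hsub).circleIntegrable hr.le) i3]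
    refine circleIntegral.integral_congr hr.le fun z hz => ?_
    have e1 := hne z hz s hns
    have e2 := hne z hz (-s) hns'
    have e3 : z ^ 2 - (q:ℂ) = (z - s) * (z - -s) := by rw [← hs2]; ring
    have e4 : ((z - s) * (z - -s))⁻¹ = ((z - s)⁻¹ - (z - -s)⁻¹) / (2 * s) := by
      field_simp
      ring
    simp only [Eis, A, H, ← hs, e3]
    rw [div_eq_mul_inv, e4]
    ring
  have hpi : (2 * (Real.pi : ℂ) * Complex.I) ≠ 0 := Complex.two_pi_I_ne_zero
  rw [split R (by linarith) hR.ne', split 1 one_pos hs1.ne,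
    annulus_eq A ∅ Set.countable_empty hAc (fun z hz _ => hA z hz) R (by linarith),
    residue_step H hH s (by rwa [hns]) R (by rwa [hns]),
    residue_step H hH (-s) (by rwa [norm_neg, hns]) R (by rwa [norm_neg, hns])]
  have r1 : H s = ((q:ℂ) - (q:ℂ)⁻¹) / 2 * s ^ m := by
    simp only [H, ← hs2]
    rw [mul_inv_cancel₀ hs0, one_pow, zpow_sub_one₀ hs0]
    field_simp
  have r2 : H (-s) = -(((q:ℂ) - (q:ℂ)⁻¹) / 2 * ((-1) ^ k * (-s) ^ m)) := by
    have : s * (-s)⁻¹ = -1 := by field_simp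
    simp only [H, ← hs2]
    rw [this, zpow_sub_one₀ (neg_ne_zero.2 hs0)]
    field_simp
  rw [r1, r2]
  field_simp
  ring
end

section
/- Let q > 1 be real, m an integer, R a real number with R > √q, and k a natural number with k > |m|. Then ∮_{|a|=R} E(k, a)·a^{m−1} da = 0, where ∮_{|a|=R} denotes the integral over the circle of radius R centered at 0 traversed once counterclockwise (and for m < 0, a^{m−1} is the integer power of the nonzero complex number a). Consequently, the pseudo-Eisenstein series k ↦ (1/(2πi))∮_{|a|=R} E(k, a)·a^{m−1} da attached to the test function ω(a) = a^m is a finitely supported function of k. -/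
lemma aux_ne {q : ℝ} (hq : 1 < q) {R : ℝ} (hR : Real.sqrt q < R) {z : ℂ} (hz : R ≤ ‖z‖) :
    z ≠ 0 ∧ z ^ 2 - (q : ℂ) ≠ 0 := by
  have hs : 0 ≤ Real.sqrt q := Real.sqrt_nonneg q
  constructor
  · rintro rfl
    rw [norm_zero] at hz
    linarith
  · intro h
    have h1 : z ^ 2 = (q : ℂ) := sub_eq_zero.mp h
    have h2 : ‖z‖ ^ 2 = q := by
      rw [← norm_pow, h1, Complex.norm_real, Real.norm_of_nonneg (by linarith)]
    have h3 : ‖z‖ = Real.sqrt q := by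
      rw [← h2, Real.sqrt_sq (norm_nonneg z)]
    linarith

lemma aux_diff {q : ℝ} (hq : 1 < q) {R : ℝ} (hR : Real.sqrt q < R) (n : ℕ) {z : ℂ}
    (hz : R ≤ ‖z‖) :
    DifferentiableAt ℂ
      (fun a : ℂ => (((q : ℂ) * a ^ 2 - 1) / (a ^ 2 - (q : ℂ))) * (a ^ (n + 2))⁻¹) z := by
  obtain ⟨h0, h1⟩ := aux_ne hq hR hz
  have h2 : z ^ (n + 2) ≠ 0 := pow_ne_zero _ h0
  refine DifferentiableAt.mul (DifferentiableAt.div ?_ ?_ h1) (DifferentiableAt.inv ?_ h2) <;>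
    fun_prop

lemma aux_int {q : ℝ} (hq : 1 < q) {R : ℝ} (hR : Real.sqrt q < R) (n : ℕ) :
    (∮ a in C(0, R), (((q : ℂ) * a ^ 2 - 1) / (a ^ 2 - (q : ℂ))) * (a ^ (n + 2))⁻¹) = 0 := by
  set f : ℂ → ℂ := fun a => (((q : ℂ) * a ^ 2 - 1) / (a ^ 2 - (q : ℂ))) * (a ^ (n + 2))⁻¹ with hf
  have hR0 : 0 < R := lt_of_le_of_lt (Real.sqrt_nonneg q) hR
  have heq : ∀ r : ℝ, R ≤ r → (∮ a in C(0, r), f a) = ∮ a in C(0, R), f a := by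
    intro r hr
    refine Complex.circleIntegral_eq_of_differentiable_on_annulus_off_countable hR0 hr
      Set.countable_empty ?_ ?_
    · intro z hz
      have : R ≤ ‖z‖ := by simpa using hz.2
      exact (aux_diff hq hR n this).continuousAt.continuousWithinAt
    · intro z hz
      have : R < ‖z‖ := by simpa using hz.1.2
      exact aux_diff hq hR n this.le
  have hbound : ∀ r : ℝ, R ≤ r → 2 * q ≤ r →
      ‖∮ a in C(0, R), f a‖ ≤ (8 * Real.pi * q) / r := by
    intro r hr hr2
    have hr0 : 0 < r := by linarith
    rw [← heq r hr]
    have h := circleIntegral.norm_integral_le_of_norm_le_const (f := f) (c := 0)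
      (C := 4 * q / r ^ 2) hr0.le ?_
    · refine h.trans (le_of_eq ?_)
      field_simp
      ring
    · intro z hz
      have hz : ‖z‖ = r := by simpa using hz
      have e1 : ‖(q : ℂ) * z ^ 2 - 1‖ ≤ 2 * q * r ^ 2 := by
        refine (norm_sub_le _ _).trans ?_
        rw [norm_mul, norm_pow, hz, Complex.norm_real, Real.norm_of_nonneg (by linarith), norm_one]
        nlinarith
      have e2 : r ^ 2 / 2 ≤ ‖z ^ 2 - (q : ℂ)‖ := by
        refine le_trans ?_ (norm_sub_norm_le _ _)
        rw [norm_pow, hz, Complex.norm_real, Real.norm_of_nonneg (by linarith)]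
        nlinarith
      have e3 : ‖(z ^ (n + 2))⁻¹‖ ≤ (r ^ 2)⁻¹ := by
        rw [norm_inv, norm_pow, hz]
        apply inv_anti₀ (by positivity)
        exact pow_le_pow_right₀ (by linarith) (by omega)
      simp only [hf]
      rw [norm_mul, norm_div]
      calc _ ≤ (2 * q * r ^ 2) / (r ^ 2 / 2) * (r ^ 2)⁻¹ := by gcongr
        _ = 4 * q / r ^ 2 := by field_simp; ring
  have hlim : Filter.Tendsto (fun r : ℝ => (8 * Real.pi * q) / r) Filter.atTop (nhds 0) :=
    Filter.Tendsto.div_atTop tendsto_const_nhds Filter.tendsto_id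
  have : ‖∮ a in C(0, R), f a‖ ≤ 0 := by
    refine ge_of_tendsto hlim ?_
    filter_upwards [Filter.eventually_ge_atTop R, Filter.eventually_ge_atTop (2 * q)] with r h1 h2
    exact hbound r h1 h2
  exact norm_le_zero_iff.mp this

/-- For `k > |m|` the contour integral `∮_{|a|=R} E(k, a)·a^(m−1) da` vanishes; consequently
the pseudo-Eisenstein series attached to `ω(a) = a^m` is a finitely supported function
of `k`. -/
theorem stmt_16 (q : ℝ) (hq : 1 < q) (m : ℤ) (R : ℝ) (hR : Real.sqrt q < R) :
    (∀ k : ℕ, m.natAbs < k →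
      (∮ a in C(0, R), Eis q a k * a ^ (m - 1)) = 0) ∧
    (Function.support fun k : ℕ =>
      (1 / (2 * (Real.pi : ℂ) * Complex.I)) *
        ∮ a in C(0, R), Eis q a k * a ^ (m - 1)).Finite := by
  have hR0 : 0 < R := lt_of_le_of_lt (Real.sqrt_nonneg q) hR
  have main : ∀ k : ℕ, m.natAbs < k →
      (∮ a in C(0, R), Eis q a k * a ^ (m - 1)) = 0 := by
    intro k hk
    obtain ⟨p, hp⟩ : ∃ p : ℕ, (k : ℤ) + (m - 1) = p := ⟨((k : ℤ) + (m - 1)).toNat, by omega⟩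
    obtain ⟨n, hn⟩ : ∃ n : ℕ, (k : ℤ) - (m - 1) = (n + 2 : ℕ) :=
      ⟨((k : ℤ) - (m - 1) - 2).toNat, by omega⟩
    have hcongr : Set.EqOn (fun a : ℂ => Eis q a k * a ^ (m - 1))
        (fun a : ℂ => (Real.sqrt q : ℂ) ^ k * a ^ p + (Real.sqrt q : ℂ) ^ k *
          ((((q : ℂ) * a ^ 2 - 1) / (a ^ 2 - (q : ℂ))) * (a ^ (n + 2))⁻¹))
        (Metric.sphere 0 R) := by
      intro a ha
      have ha : ‖a‖ = R := by simpa using ha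
      obtain ⟨h0, -⟩ := aux_ne hq hR ha.ge
      have e1 : a ^ k * a ^ (m - 1) = a ^ p := by
        rw [← zpow_natCast a k, ← zpow_add₀ h0, hp, zpow_natCast]
      have e2 : (a⁻¹) ^ k * a ^ (m - 1) = (a ^ (n + 2))⁻¹ := by
        rw [← zpow_natCast a (n + 2), ← hn, ← zpow_neg, inv_pow, ← zpow_natCast a k,
          ← zpow_neg, ← zpow_add₀ h0]
        congr 1
        ring
      simp only [Eis]
      rw [← e1, ← e2, mul_pow, mul_pow]
      ring
    rw [circleIntegral.integral_congr hR0.le hcongr, circleIntegral.integral_add]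
    · rw [circleIntegral.integral_const_mul, circleIntegral.integral_const_mul, aux_int hq hR n]
      have : (∮ a in C(0, R), a ^ p) = 0 := by
        have := circleIntegral.integral_sub_zpow_of_ne (n := (p : ℤ)) (by omega) 0 0 R
        simpa using this
      rw [this]
      simp
    · exact ContinuousOn.circleIntegrable hR0.le (by fun_prop)
    · refine ContinuousOn.circleIntegrable hR0.le (ContinuousOn.mul continuousOn_const ?_)
      intro a ha
      have ha : ‖a‖ = R := by simpa using ha
      exact (aux_diff hq hR n ha.ge).continuousAt.continuousWithinAt
  refine ⟨main, (Set.finite_Iic m.natAbs).subset ?_⟩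
  intro k hk
  by_contra h
  apply hk
  have : m.natAbs < k := by simpa using h
  simp only [main k this, mul_zero]
end
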